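/- Let p ≥ 0, let r_1, …, r_s ≥ 1, and assume s ≤ n − p. Then every X ∈ ℋ_{p; r_1,…,r_s} admits a decomposition X = X_0 + Σ_{α=1}^{s} B_α X_α, where X_0 ∈ ℋ_{p; r_1,…,r_s} is traceless (T_α X_0 = 0 for all α) and X_α ∈ ℋ_{p−1; r_1,…,r_α−1,…,r_s}; moreover the traceless part X_0 is uniquely determined by X. (Trace decomposition.) -/

import Mathlib

open scoped BigOperators

namespace FockVar

/-- Multi-indices on `Fin n` of degree exactly `d` (encoding a symmetric slot of rank `d`). -/
abbrev MIe (n d : ℕ) : Type := {J : Fin n → ℕ // (∑ i, J i) = d}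

/-- The space of tensors with `k` antisymmetric `Fin n` indices and `s` symmetric slots of
ranks `r 0, …, r (s-1)` (symmetric slots encoded by multi-indices, so that the symmetry
in each slot is automatic). -/
abbrev TT (n k s : ℕ) (r : Fin s → ℕ) : Type :=
  (Fin k → Fin n) → ((α : Fin s) → MIe n (r α)) → ℝ

/-- Antisymmetry in the `k` `Fin n`-indices: membership in `ℋ_{k;r_1,…,r_s}`. -/
def IsAnti {n k s : ℕ} {r : Fin s → ℕ} (X : TT n k s r) : Prop :=
  ∀ (τ : Equiv.Perm (Fin k)) (i : Fin k → Fin n) (I : (α : Fin s) → MIe n (r α)),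
    X (i ∘ τ) I = ((Equiv.Perm.sign τ : ℤ) : ℝ) * X i I

/-- Evaluation of a tensor on raw data, with built-in degree and arity checks
(returns `0` on mismatch). -/
def appT {n k s : ℕ} {r : Fin s → ℕ} (X : TT n k s r) {k' : ℕ}
    (i : Fin k' → Fin n) (K : Fin s → (Fin n → ℕ)) : ℝ :=
  if h : k' = k ∧ ∀ α, (∑ j, K α j) = r α then
    X (fun a => i (Fin.cast h.1.symm a)) (fun α => ⟨K α, h.2 α⟩)
  else 0

/-- `J - e_{j₀}` (truncated subtraction). -/
def subF {n : ℕ} (J : Fin n → ℕ) (j0 : Fin n) : Fin n → ℕ :=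
  fun j => J j - (if j = j0 then 1 else 0)

/-- `J + e_{j₀}`. -/
def addF {n : ℕ} (J : Fin n → ℕ) (j0 : Fin n) : Fin n → ℕ :=
  fun j => J j + (if j = j0 then 1 else 0)

/-- The raw value of `B_α X`:
`(B_α X) = Sym_{(j_0,…,j_{r_α})} Alt_{(i_0,…,i_k)} [ δ^{j_0}_{i_0} X^{(j_1,…,j_{r_α})}_{i_1,…,i_k} ]`,
written in multi-index form. -/
noncomputable def Bval {n k s : ℕ} {r : Fin s → ℕ} (α : Fin s) (X : TT n k s r)
    {k' : ℕ} (i : Fin k' → Fin n) (K : Fin s → (Fin n → ℕ)) : ℝ :=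
  if hk : k' = k + 1 then
    ((k'.factorial : ℕ) : ℝ)⁻¹ *
      ∑ τ : Equiv.Perm (Fin k'),
        ((Equiv.Perm.sign τ : ℤ) : ℝ) *
          ((K α (i (τ ⟨0, by omega⟩)) : ℝ) / ((r α : ℝ) + 1)) *
          appT X (fun l : Fin k => i (τ (Fin.cast hk.symm l.succ)))
            (Function.update K α (subF (K α) (i (τ ⟨0, by omega⟩))))
  else 0

/-- The operator `B_α : ℋ_{k;r_1,…,r_α,…,r_s} → ℋ_{k+1;r_1,…,r_α+1,…,r_s}`. -/
noncomputable def Bop {n k s : ℕ} {r : Fin s → ℕ} (α : Fin s) (X : TT n k s r) :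
    TT n (k+1) s (Function.update r α (r α + 1)) :=
  fun i I => Bval α X i (fun β => (I β).1)

/-- The raw value of the trace `T_α X`. -/
noncomputable def Tval {n k s : ℕ} {r : Fin s → ℕ} (α : Fin s) (X : TT n k s r)
    {k' : ℕ} (i : Fin k' → Fin n) (K : Fin s → (Fin n → ℕ)) : ℝ :=
  ∑ j : Fin n, appT X (Fin.cons j i) (Function.update K α (addF (K α) j))

/-- The trace `T_α : ℋ_{k;r_1,…,r_α,…,r_s} → ℋ_{k−1;r_1,…,r_α−1,…,r_s}`. -/
noncomputable def Top {n k s : ℕ} {r : Fin s → ℕ} (α : Fin s) (X : TT n k s r) :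
    TT n (k-1) s (Function.update r α (r α - 1)) :=
  fun i I => Tval α X i (fun β => (I β).1)

/-- The degree function produced by successive applications of the operators `B_α`,
`α` running through a list. -/
def chainDeg {s : ℕ} (r : Fin s → ℕ) : List (Fin s) → (Fin s → ℕ)
  | [] => r
  | α :: l => Function.update (chainDeg r l) α (chainDeg r l α + 1)

/-- Iterated application `B_{α_1} ∘ ⋯ ∘ B_{α_t}` along a list `[α_1, …, α_t]`
(the head applied last), each `B` acting on the space produced by the previous ones. -/
noncomputable def chainB {n k s : ℕ} {r : Fin s → ℕ} :
    (l : List (Fin s)) → TT n k s r → TT n (k + l.length) s (chainDeg r l)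
  | [], X => X
  | α :: l, X => Bop α (chainB l X)


noncomputable instance instFintypeMIe (n d : ℕ) : Fintype (MIe n d) := by
  have : Finite (MIe n d) := by
    refine Finite.of_injective
      (fun J : MIe n d => fun i : Fin n => (⟨J.1 i, ?_⟩ : Fin (d + 1))) ?_
    · have h := Finset.single_le_sum (f := J.1) (fun _ _ => Nat.zero_le _) (Finset.mem_univ i)
      rw [J.2] at h
      omega
    · intro J J' h
      apply Subtype.ext
      funext i
      have := congrFun h i
      simpa using this
  exact Fintype.ofFinite _

/-- Multinomial weight. -/
noncomputable def wt {n s : ℕ} (K : Fin s → (Fin n → ℕ)) : ℝ :=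
  ∏ β, (((∑ j, K β j).factorial : ℝ) / ∏ j, ((K β j).factorial : ℝ))

lemma wt_pos {n s : ℕ} (K : Fin s → (Fin n → ℕ)) : 0 < wt K := by
  unfold wt
  positivity

lemma sum_addF {n : ℕ} (J : Fin n → ℕ) (j : Fin n) : ∑ i, addF J j i = (∑ i, J i) + 1 := by
  simp [addF, Finset.sum_add_distrib]

lemma subF_addF {n : ℕ} (J : Fin n → ℕ) (j : Fin n) : subF (addF J j) j = J := by
  funext i; simp [subF, addF]

lemma addF_subF {n : ℕ} (J : Fin n → ℕ) (j : Fin n) (h : J j ≠ 0) : addF (subF J j) j = J := by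
  funext i
  by_cases hi : i = j
  · subst hi; simp [subF, addF]; omega
  · simp [subF, addF, hi]

lemma wt_addF {n s : ℕ} (K : Fin s → (Fin n → ℕ)) (α : Fin s) (j : Fin n) :
    wt (Function.update K α (addF (K α) j)) *
      (((K α j : ℝ) + 1) / (((∑ i, K α i : ℕ) : ℝ) + 1)) = wt K := by
  have key : (((∑ i, addF (K α) j i).factorial : ℝ) / ∏ i, ((addF (K α) j i).factorial : ℝ)) *
      (((K α j : ℝ) + 1) / (((∑ i, K α i : ℕ) : ℝ) + 1))
      = (((∑ i, K α i).factorial : ℝ) / ∏ i, ((K α i).factorial : ℝ)) := by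
    rw [sum_addF, Nat.factorial_succ]
    have hp : ∏ i, ((addF (K α) j i).factorial : ℝ)
        = ((K α j : ℝ) + 1) * ∏ i, ((K α i).factorial : ℝ) := by
      rw [← Finset.mul_prod_erase _ _ (Finset.mem_univ j),
        ← Finset.mul_prod_erase Finset.univ (fun i => ((K α i).factorial : ℝ))
          (Finset.mem_univ j), ← mul_assoc]
      congr 1
      · simp [addF, Nat.factorial_succ]
      · refine Finset.prod_congr rfl fun i hi => ?_
        simp [addF, Finset.ne_of_mem_erase hi]
    rw [hp]
    have h1 : (∏ i, ((K α i).factorial : ℝ)) ≠ 0 := by positivity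
    have h2 : ((K α j : ℝ) + 1) ≠ 0 := by positivity
    have h3 : (((∑ i, K α i : ℕ) : ℝ) + 1) ≠ 0 := by positivity
    rw [Nat.cast_mul, Nat.cast_add, Nat.cast_one]
    field_simp
  unfold wt
  rw [← Finset.mul_prod_erase _ _ (Finset.mem_univ α),
    ← Finset.mul_prod_erase Finset.univ
      (fun β => ((∑ j, K β j).factorial : ℝ) / ∏ j, ((K β j).factorial : ℝ)) (Finset.mem_univ α),
    ← key]
  simp only [Function.update_self]
  have : ∀ β ∈ Finset.univ.erase α, (((∑ i, Function.update K α (addF (K α) j) β i).factorial : ℝ) /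
        ∏ i, ((Function.update K α (addF (K α) j) β i).factorial : ℝ)) =
      (((∑ i, K β i).factorial : ℝ) / ∏ i, ((K β i).factorial : ℝ)) := by
    intro β hβ
    simp [Function.update_of_ne (Finset.ne_of_mem_erase hβ)]
  rw [Finset.prod_congr rfl this]
  ring

/-- weighted pairing -/
noncomputable def pr {n k s : ℕ} {r : Fin s → ℕ} (X Y : TT n k s r) : ℝ :=
  ∑ i, ∑ I, wt (fun β => (I β).1) * (X i I * Y i I)

lemma pr_self {n k s : ℕ} {r : Fin s → ℕ} (X : TT n k s r) (h : pr X X = 0) : X = 0 := by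
  unfold pr at h
  have hnn : ∀ (i : Fin k → Fin n) (I : (β : Fin s) → MIe n (r β)),
      0 ≤ wt (fun β => (I β).1) * (X i I * X i I) := fun i I =>
    mul_nonneg (wt_pos _).le (mul_self_nonneg _)
  funext i I
  rw [Finset.sum_eq_zero_iff_of_nonneg
    (fun i _ => Finset.sum_nonneg fun I _ => hnn i I)] at h
  have h2 := h i (Finset.mem_univ _)
  rw [Finset.sum_eq_zero_iff_of_nonneg (fun I _ => hnn i I)] at h2
  have h3 := h2 I (Finset.mem_univ _)
  rcases mul_eq_zero.1 h3 with h4 | h4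
  · exact absurd h4 (wt_pos _).ne'
  · simpa using h4

lemma appT_eq {n k s : ℕ} {r : Fin s → ℕ} (X : TT n k s r) (i : Fin k → Fin n)
    (K : Fin s → (Fin n → ℕ)) (h : ∀ α, (∑ j, K α j) = r α) :
    appT X i K = X i (fun α => ⟨K α, h α⟩) := by
  unfold appT
  rw [dif_pos ⟨rfl, h⟩]
  rfl

lemma appT_perm {n k s : ℕ} {r : Fin s → ℕ} (X : TT n k s r) (hX : IsAnti X)
    (τ : Equiv.Perm (Fin k)) (i : Fin k → Fin n) (K : Fin s → (Fin n → ℕ)) :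
    appT X (i ∘ τ) K = ((Equiv.Perm.sign τ : ℤ) : ℝ) * appT X i K := by
  by_cases h : ∀ α, (∑ j, K α j) = r α
  · rw [appT_eq _ _ _ h, appT_eq _ _ _ h, hX]
  · unfold appT
    rw [dif_neg (fun h' => h h'.2), dif_neg (fun h' => h h'.2), mul_zero]

/-- Unsigned summand of `Bval`. -/
noncomputable def Bs {n k s : ℕ} {r : Fin s → ℕ} (α : Fin s) (X : TT n k s r)
    (i : Fin (k+1) → Fin n) (K : Fin s → (Fin n → ℕ)) : ℝ :=
  ((K α (i 0) : ℝ) / ((r α : ℝ) + 1)) *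
    appT X (fun l : Fin k => i l.succ) (Function.update K α (subF (K α) (i 0)))

lemma Bval_eq {n k s : ℕ} {r : Fin s → ℕ} (α : Fin s) (X : TT n k s r)
    (i : Fin (k+1) → Fin n) (K : Fin s → (Fin n → ℕ)) :
    Bval α X i K = (((k+1).factorial : ℕ) : ℝ)⁻¹ * ∑ τ : Equiv.Perm (Fin (k+1)),
      ((Equiv.Perm.sign τ : ℤ) : ℝ) * Bs α X (i ∘ τ) K := by
  unfold Bval
  rw [dif_pos rfl]
  congr 1
  refine Finset.sum_congr rfl fun τ _ => ?_
  rw [mul_assoc]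
  rfl

lemma sign_sq {k : ℕ} (τ : Equiv.Perm (Fin k)) :
    ((Equiv.Perm.sign τ : ℤ) : ℝ) * ((Equiv.Perm.sign τ : ℤ) : ℝ) = 1 := by
  rcases Int.units_eq_one_or (Equiv.Perm.sign τ) with h | h <;> simp [h]

lemma Bval_perm {n k s : ℕ} {r : Fin s → ℕ} (α : Fin s) (X : TT n k s r)
    (σ : Equiv.Perm (Fin (k+1))) (i : Fin (k+1) → Fin n) (K : Fin s → (Fin n → ℕ)) :
    Bval α X (i ∘ σ) K = ((Equiv.Perm.sign σ : ℤ) : ℝ) * Bval α X i K := by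
  rw [Bval_eq, Bval_eq, mul_left_comm]
  refine congrArg (fun x => (((k+1).factorial : ℕ) : ℝ)⁻¹ * x) ?_
  rw [Finset.mul_sum]
  refine Fintype.sum_equiv (Equiv.mulLeft σ) _ _ fun τ => ?_
  rw [Equiv.coe_mulLeft, Equiv.Perm.sign_mul]
  have : (i ∘ σ) ∘ τ = i ∘ (σ * τ : Equiv.Perm (Fin (k+1))) := rfl
  rw [this, ← mul_assoc, Units.val_mul, Int.cast_mul, ← mul_assoc, sign_sq, one_mul]

lemma Tval_perm {n k s : ℕ} {r : Fin s → ℕ} (α : Fin s) (X : TT n (k+1) s r) (hX : IsAnti X)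
    (σ : Equiv.Perm (Fin k)) (i : Fin k → Fin n) (K : Fin s → (Fin n → ℕ)) :
    Tval α X (i ∘ σ) K = ((Equiv.Perm.sign σ : ℤ) : ℝ) * Tval α X i K := by
  unfold Tval
  rw [Finset.mul_sum]
  refine Finset.sum_congr rfl fun j _ => ?_
  have h : (Fin.cons j (i ∘ σ) : Fin (k+1) → Fin n)
      = (Fin.cons j i : Fin (k+1) → Fin n) ∘ (Equiv.Perm.decomposeFin.symm (0, σ)) := by
    funext l
    refine Fin.cases ?_ (fun l => ?_) l
    · simp
    · simp
  rw [h, appT_perm X hX]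
  simp

lemma slot_sum {n k s : ℕ} {r : Fin s → ℕ} (hr : ∀ α, 1 ≤ r α) (α : Fin s)
    (Y : TT n k s (Function.update r α (r α - 1))) (X : TT n (k+1) s r)
    (j : Fin n) (i : Fin k → Fin n) :
    ∑ I : ((β : Fin s) → MIe n (r β)), wt (fun β => (I β).1) *
        (Bs α Y (Fin.cons j i) (fun β => (I β).1) * X (Fin.cons j i) I)
      = ∑ K : ((β : Fin s) → MIe n (Function.update r α (r α - 1) β)),
        wt (fun β => (K β).1) * (Y i K *
          appT X (Fin.cons j i : Fin (k+1) → Fin n)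
            (Function.update (fun β => (K β).1) α (addF (K α).1 j))) := by
  have hra := hr α
  have hdeg : ∀ (K : (β : Fin s) → MIe n (Function.update r α (r α - 1) β)) (β : Fin s),
      ∑ l, (Function.update (fun β => (K β).1) α (addF (K α).1 j)) β l = r β := by
    intro K β
    by_cases hb : β = α
    · subst hb
      have := (K β).2
      simp only [Function.update_self] at this ⊢
      rw [sum_addF, this]; omega
    · have := (K β).2
      rw [Function.update_of_ne hb, this, Function.update_of_ne hb]
  symm
  refine Finset.sum_of_injOn (fun K β => ⟨_, hdeg K β⟩) ?_ ?_ ?_ ?_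
  · intro K _ K' _ h
    funext β
    apply Subtype.ext
    have hβ := congrArg Subtype.val (congrFun h β)
    by_cases hb : β = α
    · subst hb
      simp only [Function.update_self] at hβ
      rw [← subF_addF (K β).1 j, hβ, subF_addF]
    · simpa [Function.update_of_ne hb] using hβ
  · intro K _; simp
  · intro I _ hI
    by_cases h0 : (I α).1 j = 0
    · simp [Bs, h0]
    · exfalso
      apply hI
      have hadd := addF_subF (I α).1 j h0
      have hd : ∀ β, ∑ l, (Function.update (fun β => (I β).1) α (subF (I α).1 j)) β l
          = Function.update r α (r α - 1) β := by
        intro β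
        by_cases hb : β = α
        · subst hb
          have h1 := sum_addF (subF (I β).1 j) j
          rw [hadd, (I β).2] at h1
          simp only [Function.update_self]
          omega
        · rw [Function.update_of_ne hb, Function.update_of_ne hb]
          exact (I β).2
      refine ⟨fun β => ⟨_, hd β⟩, by simp, ?_⟩
      funext β
      apply Subtype.ext
      by_cases hb : β = α
      · subst hb
        simp [hadd]
      · simp [Function.update_of_ne hb]
  · intro K _
    have hK : ∀ β, ∑ l, (K β).1 l = Function.update r α (r α - 1) β := fun β => (K β).2
    rw [appT_eq _ _ _ (hdeg K)]
    have hw := wt_addF (fun β => (K β).1) α j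
    have hY : appT Y i (fun β => (K β).1) = Y i K := appT_eq _ _ _ hK
    simp only [Bs, Fin.cons_zero, Fin.cons_succ, Function.update_self, subF_addF,
      Function.update_idem]
    have hu : Function.update (fun β => (K β).1) α (K α).1 = fun β => (K β).1 :=
      Function.update_eq_self α _
    rw [hu, hY, ← hw]
    have hc : ((∑ l, (K α).1 l : ℕ) : ℝ) = ((r α - 1 : ℕ) : ℝ) := by
      rw [hK α, Function.update_self]
    have ha : ((addF (K α).1 j j : ℕ) : ℝ) = ((K α).1 j : ℝ) + 1 := by simp [addF]
    rw [hc, ha]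
    ring

lemma adj {n k s : ℕ} {r : Fin s → ℕ} (hr : ∀ α, 1 ≤ r α) (α : Fin s)
    (Y : TT n k s (Function.update r α (r α - 1))) (X : TT n (k+1) s r) (hX : IsAnti X) :
    pr (fun i I => Bval α Y i (fun β => (I β).1)) X
      = pr Y (fun i K => Tval α X i (fun β => (K β).1)) := by
  have step1 : pr (fun i I => Bval α Y i (fun β => (I β).1)) X
      = ∑ i, ∑ I : ((β : Fin s) → MIe n (r β)), wt (fun β => (I β).1) *
          (Bs α Y i (fun β => (I β).1) * X i I) := by
    have e1 : pr (fun i I => Bval α Y i (fun β => (I β).1)) X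
        = (((k+1).factorial : ℕ) : ℝ)⁻¹ * ∑ τ : Equiv.Perm (Fin (k+1)), ∑ i,
          ∑ I : ((β : Fin s) → MIe n (r β)), wt (fun β => (I β).1) *
          (Bs α Y (i ∘ τ) (fun β => (I β).1) * X (i ∘ τ) I) := by
      unfold pr
      conv_rhs => rw [Finset.sum_comm, Finset.mul_sum]
      refine Finset.sum_congr rfl fun i _ => ?_
      conv_rhs => rw [Finset.sum_comm, Finset.mul_sum]
      refine Finset.sum_congr rfl fun I _ => ?_
      beta_reduce
      rw [Bval_eq]
      simp only [hX _ i I]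
      rw [mul_assoc, mul_left_comm]
      refine congrArg (fun x => (((k+1).factorial : ℕ) : ℝ)⁻¹ * x) ?_
      rw [Finset.sum_mul, Finset.mul_sum]
      refine Finset.sum_congr rfl fun τ _ => ?_
      ring
    rw [e1]
    have e2 : ∀ τ : Equiv.Perm (Fin (k+1)), (∑ i : Fin (k+1) → Fin n,
          ∑ I : ((β : Fin s) → MIe n (r β)), wt (fun β => (I β).1) *
          (Bs α Y (i ∘ τ) (fun β => (I β).1) * X (i ∘ τ) I))
        = ∑ i, ∑ I : ((β : Fin s) → MIe n (r β)), wt (fun β => (I β).1) *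
          (Bs α Y i (fun β => (I β).1) * X i I) := by
      intro τ
      exact Fintype.sum_equiv (Equiv.arrowCongr τ.symm (Equiv.refl (Fin n))) _ _ (fun i => rfl)
    rw [Finset.sum_congr rfl (fun τ _ => e2 τ), Finset.sum_const, Finset.card_univ,
      Fintype.card_perm, Fintype.card_fin, nsmul_eq_mul, ← mul_assoc, inv_mul_cancel₀, one_mul]
    positivity
  rw [step1, ← (Fin.consEquiv (fun _ : Fin (k+1) => Fin n)).sum_comp, Fintype.sum_prod_type,
    Finset.sum_comm]
  unfold pr
  refine Finset.sum_congr rfl fun i _ => ?_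
  have := fun j => slot_sum hr α Y X j i
  refine (Finset.sum_congr rfl (fun j _ => this j)).trans ?_
  rw [Finset.sum_comm]
  refine Finset.sum_congr rfl fun K _ => ?_
  simp only [Tval, Finset.mul_sum]

lemma appT_lin {n k s : ℕ} {r : Fin s → ℕ} (c : ℝ) (X Y : TT n k s r) {k' : ℕ}
    (i : Fin k' → Fin n) (K : Fin s → (Fin n → ℕ)) :
    appT (X + c • Y) i K = appT X i K + c * appT Y i K := by
  unfold appT
  split_ifs
  · rfl
  · simp

lemma Tval_lin {n k s : ℕ} {r : Fin s → ℕ} (α : Fin s) (c : ℝ) (X Y : TT n k s r) {k' : ℕ}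
    (i : Fin k' → Fin n) (K : Fin s → (Fin n → ℕ)) :
    Tval α (X + c • Y) i K = Tval α X i K + c * Tval α Y i K := by
  simp only [Tval, appT_lin, Finset.sum_add_distrib, Finset.mul_sum]

lemma Bval_lin {n k s : ℕ} {r : Fin s → ℕ} (α : Fin s) (c : ℝ) (X Y : TT n k s r)
    (i : Fin (k+1) → Fin n) (K : Fin s → (Fin n → ℕ)) :
    Bval α (X + c • Y) i K = Bval α X i K + c * Bval α Y i K := by
  simp only [Bval_eq, Bs, appT_lin, mul_add, Finset.sum_add_distrib, Finset.mul_sum]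
  congr 1
  refine Finset.sum_congr rfl fun τ _ => ?_
  ring

lemma IsAnti.lin {n k s : ℕ} {r : Fin s → ℕ} {X Y : TT n k s r} (hX : IsAnti X)
    (hY : IsAnti Y) (c : ℝ) : IsAnti (X + c • Y) := by
  intro τ i I
  simp only [Pi.add_apply, Pi.smul_apply, smul_eq_mul, hX τ i I, hY τ i I]
  ring

lemma IsAnti.zero {n k s : ℕ} {r : Fin s → ℕ} : IsAnti (0 : TT n k s r) := by
  intro τ i I; simp

/-- The pairing as a bilinear form. -/
noncomputable def prB {n k s : ℕ} {r : Fin s → ℕ} : LinearMap.BilinForm ℝ (TT n k s r) :=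
  LinearMap.mk₂ ℝ pr
    (by intro a b c; simp only [pr, Pi.add_apply, add_mul, mul_add, Finset.sum_add_distrib])
    (by
      intro c a b
      simp only [pr, Pi.smul_apply, smul_eq_mul, Finset.mul_sum]
      refine Finset.sum_congr rfl fun i _ => Finset.sum_congr rfl fun I _ => ?_
      ring)
    (by intro a b c; simp only [pr, Pi.add_apply, mul_add, Finset.sum_add_distrib])
    (by
      intro c a b
      simp only [pr, Pi.smul_apply, smul_eq_mul, Finset.mul_sum]
      refine Finset.sum_congr rfl fun i _ => Finset.sum_congr rfl fun I _ => ?_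
      ring)

lemma prB_apply {n k s : ℕ} {r : Fin s → ℕ} (X Y : TT n k s r) : prB X Y = pr X Y := rfl

lemma pr_comm {n k s : ℕ} {r : Fin s → ℕ} (X Y : TT n k s r) : pr X Y = pr Y X := by
  simp only [pr, mul_comm]

/-- The total `∑ B_α X_α`. -/
noncomputable def Btot {n k s : ℕ} {r : Fin s → ℕ}
    (Y : (α : Fin s) → TT n k s (Function.update r α (r α - 1))) : TT n (k+1) s r :=
  fun i I => ∑ α, Bval α (Y α) i (fun β => (I β).1)

lemma Btot_lin {n k s : ℕ} {r : Fin s → ℕ} (c : ℝ)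
    (Y Z : (α : Fin s) → TT n k s (Function.update r α (r α - 1))) :
    Btot (Y + c • Z) = Btot Y + c • Btot Z := by
  funext i I
  have : ∀ α, (Y + c • Z) α = Y α + c • Z α := fun _ => rfl
  simp only [Btot, this, Bval_lin, Pi.add_apply, Pi.smul_apply, smul_eq_mul,
    Finset.sum_add_distrib, Finset.mul_sum]

lemma Btot_zero {n k s : ℕ} {r : Fin s → ℕ} :
    Btot (0 : (α : Fin s) → TT n k s (Function.update r α (r α - 1))) = 0 := by
  have h := Btot_lin (-1) (0 : (α : Fin s) → TT n k s (Function.update r α (r α - 1))) 0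
  simpa using h

lemma Btot_anti {n k s : ℕ} {r : Fin s → ℕ}
    (Y : (α : Fin s) → TT n k s (Function.update r α (r α - 1))) : IsAnti (Btot Y) := by
  intro τ i I
  simp only [Btot, Bval_perm, Finset.mul_sum]

lemma pr_Btot {n k s : ℕ} {r : Fin s → ℕ} (hr : ∀ α, 1 ≤ r α)
    (Y : (α : Fin s) → TT n k s (Function.update r α (r α - 1)))
    (X : TT n (k+1) s r) (hX : IsAnti X) :
    pr (Btot Y) X = ∑ α, pr (Y α) (fun i K => Tval α X i (fun β => (K β).1)) := by
  have h : Btot Y = ∑ α, (fun i (I : (β : Fin s) → MIe n (r β)) =>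
      Bval α (Y α) i (fun β => (I β).1)) := by
    funext i I
    simp only [Btot, Finset.sum_apply]
  rw [h, ← prB_apply, map_sum, LinearMap.sum_apply]
  exact Finset.sum_congr rfl fun α _ => adj hr α (Y α) X hX

/-- The image of `Btot` on antisymmetric families. -/
noncomputable def Wsub (n k s : ℕ) (r : Fin s → ℕ) : Submodule ℝ (TT n (k+1) s r) where
  carrier := {Z | ∃ Y : (α : Fin s) → TT n k s (Function.update r α (r α - 1)),
    (∀ α, IsAnti (Y α)) ∧ Btot Y = Z}
  zero_mem' := ⟨0, fun _ => IsAnti.zero, Btot_zero⟩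
  add_mem' := by
    rintro _ _ ⟨Y, hY, rfl⟩ ⟨Z, hZ, rfl⟩
    refine ⟨Y + (1:ℝ) • Z, fun α => (hY α).lin (hZ α) 1, ?_⟩
    rw [Btot_lin, one_smul]
  smul_mem' := by
    rintro c _ ⟨Y, hY, rfl⟩
    refine ⟨0 + c • Y, fun α => IsAnti.zero.lin (hY α) c, ?_⟩
    rw [Btot_lin, Btot_zero, zero_add]

lemma exists_decomp {n k s : ℕ} {r : Fin s → ℕ} (X : TT n (k+1) s r) :
    ∃ Y : (α : Fin s) → TT n k s (Function.update r α (r α - 1)), (∀ α, IsAnti (Y α)) ∧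
      ∀ Z : (α : Fin s) → TT n k s (Function.update r α (r α - 1)), (∀ α, IsAnti (Z α)) →
        pr (Btot Z) (X - Btot Y) = 0 := by
  have hrefl : (prB : LinearMap.BilinForm ℝ (TT n (k+1) s r)).IsRefl := by
    intro a b h
    rw [prB_apply] at h ⊢
    rw [pr_comm]; exact h
  have hnd : ((prB : LinearMap.BilinForm ℝ (TT n (k+1) s r)).restrict
      (Wsub n k s r)).Nondegenerate := by
    constructor
    · intro x hx
      exact Subtype.ext (pr_self _ (hx x))
    · intro x hx
      exact Subtype.ext (pr_self _ (hx x))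
  have hc := LinearMap.BilinForm.isCompl_orthogonal_of_restrict_nondegenerate hrefl hnd
  have hX : X ∈ Wsub n k s r ⊔ prB.orthogonal (Wsub n k s r) := by
    rw [hc.sup_eq_top]; trivial
  obtain ⟨_, ⟨Y, hY, rfl⟩, z, hz, hXz⟩ := Submodule.mem_sup.1 hX
  refine ⟨Y, hY, fun Z hZ => ?_⟩
  have : X - Btot Y = z := by rw [← hXz]; simp
  rw [this]
  exact hz _ ⟨Z, hZ, rfl⟩

/-- trace decomposition. Every `X ∈ ℋ_{p;r_1,…,r_s}` with `r_α ≥ 1` and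
`s ≤ n − p` decomposes as `X = X_0 + Σ_α B_α X_α` with `X_0` traceless, and the traceless
part `X_0` is uniquely determined by `X`. -/
theorem trace_decomposition (n p s : ℕ) (hn : 1 ≤ n) (hs : 1 ≤ s)
    (r : Fin s → ℕ) (hr : ∀ α, 1 ≤ r α) (hsp : s + p ≤ n)
    (X : TT n p s r) (hX : IsAnti X) :
    ∃ (X0 : TT n p s r) (X' : (α : Fin s) → TT n (p-1) s (Function.update r α (r α - 1))),
      IsAnti X0 ∧ (∀ α, Top α X0 = 0) ∧ (∀ α, IsAnti (X' α)) ∧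
      (∀ (i : Fin p → Fin n) (I : (β : Fin s) → MIe n (r β)),
        X i I = X0 i I + ∑ α : Fin s, Bval α (X' α) i (fun β => (I β).1)) ∧
      (∀ (Y0 : TT n p s r)
          (Y' : (α : Fin s) → TT n (p-1) s (Function.update r α (r α - 1))),
        IsAnti Y0 → (∀ α, Top α Y0 = 0) → (∀ α, IsAnti (Y' α)) →
        (∀ (i : Fin p → Fin n) (I : (β : Fin s) → MIe n (r β)),
          X i I = Y0 i I + ∑ α : Fin s, Bval α (Y' α) i (fun β => (I β).1)) →
        Y0 = X0) := by
  cases p with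
  | zero =>
    refine ⟨X, fun _ => 0, hX, ?_, fun _ => IsAnti.zero, ?_, ?_⟩
    · intro α
      funext i I
      simp [Top, Tval, appT]
    · intro i I
      simp [Bval]
    · intro Y0 Y' _ _ _ h
      funext i I
      have := h i I
      simpa [Bval] using this.symm
  | succ k =>
    obtain ⟨Y, hY, hor⟩ := exists_decomp X
    have hanti : IsAnti (X - Btot Y) := by
      have := hX.lin (Btot_anti Y) (-1)
      rwa [neg_one_smul, ← sub_eq_add_neg] at this
    have htr : ∀ α, Top α (X - Btot Y) = 0 := by
      intro α
      have hTa : ∀ β : Fin s, IsAnti (k := k) (Top β (X - Btot Y)) :=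
        fun β σ i K => Tval_perm β (X - Btot Y) hanti σ i _
      have h := hor (fun β => Top β (X - Btot Y)) hTa
      rw [pr_Btot hr _ _ hanti, Finset.sum_eq_zero_iff_of_nonneg] at h
      · exact pr_self _ (h α (Finset.mem_univ _))
      · intro β _
        exact Finset.sum_nonneg fun i _ => Finset.sum_nonneg fun I _ =>
          mul_nonneg (wt_pos _).le (mul_self_nonneg _)
    refine ⟨X - Btot Y, Y, hanti, htr, hY, ?_, ?_⟩
    · intro i I
      change X i I = (X i I - Btot Y i I) + Btot Y i I
      ring
    · intro Y0 (Y' : (α : Fin s) → TT n k s (Function.update r α (r α - 1))) h0 ht hY' hdec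
      have hXe : X = Y0 + Btot Y' := by
        funext i I
        exact hdec i I
      have hZ : IsAnti (Y0 + (-1 : ℝ) • (X - Btot Y)) := h0.lin hanti (-1)
      have hZe : Y0 + (-1 : ℝ) • (X - Btot Y) = Btot (Y + (-1 : ℝ) • Y') := by
        rw [Btot_lin, hXe]
        module
      have hT : ∀ α, (fun (i : Fin k → Fin n)
          (K : (β : Fin s) → MIe n (Function.update r α (r α - 1) β)) =>
          Tval α (Y0 + (-1 : ℝ) • (X - Btot Y)) i (fun β => (K β).1)) = 0 := by
        intro α
        funext i K
        rw [Tval_lin]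
        have h1 := congrFun (congrFun (ht α) i) K
        have h2 := congrFun (congrFun (htr α) i) K
        change Tval α Y0 i _ = 0 at h1
        change Tval α (X - Btot Y) i _ = 0 at h2
        rw [h1, h2]
        simp
      have hz := pr_Btot hr (Y + (-1 : ℝ) • Y') _ hZ
      rw [← hZe] at hz
      have hz0 : pr (Y0 + (-1 : ℝ) • (X - Btot Y)) (Y0 + (-1 : ℝ) • (X - Btot Y)) = 0 := by
        rw [hz]
        refine Finset.sum_eq_zero fun α _ => ?_
        rw [hT α]
        simp [pr]
      have := pr_self _ hz0
      rw [neg_one_smul, ← sub_eq_add_neg, sub_eq_zero] at this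
      exact this

end FockVar
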